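/- Let (a_n)_{n≥1} be a sequence of distinct positive real numbers with inf_{1≤m≠n≤N} |a_m − a_n| ≥ c(N) for all N, where (c(N))_{N≥1} is a monotone decreasing sequence of positive reals, and let ε > 0. Let f be a differentiable function on [inf_n a_n, ∞) with f(a_n) > 0 for all n, and suppose there exists δ₀ > 0 such that |f'(x)| ≥ δ₀ for all x ∈ [inf_n a_n, ∞). Then for almost all α ∈ [0,1] there exists N₀(α) such that for all N ≥ N₀(α): δ_min^α for the sequence (f(a_n))_{n≥1} satisfies δ_min^α(N) ≥ c(N)·δ₀ / (D̃_N · log N · (log₂ N)^{1+ε}) and δ_min^α(N) ≤ 1 − c(N)·δ₀ / (D̃_N · log N · (log₂ N)^{1+ε}), where D̃_N = #{|f(a_m) − f(a_n)| : 1 ≤ m ≠ n ≤ N}. -/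

import Mathlib

open MeasureTheory Filter

/-- Distance from a real number to the nearest integer. -/
noncomputable def nint (x : ℝ) : ℝ := |x - round x|

/-- `deltaMin a α N` is the minimal gap
`min { ‖α (a_m − a_n)‖ : 1 ≤ m ≠ n ≤ N }`. -/
noncomputable def deltaMin (a : ℕ → ℝ) (α : ℝ) (N : ℕ) : ℝ :=
  sInf {d : ℝ | ∃ m n : ℕ, 1 ≤ m ∧ m ≤ N ∧ 1 ≤ n ∧ n ≤ N ∧ m ≠ n ∧
    d = nint (α * (a m - a n))}

/-- `Dcard a N` is the number of distinct positive differences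
`#{ |a_m − a_n| : 1 ≤ m ≠ n ≤ N }`. -/
noncomputable def Dcard (a : ℕ → ℝ) (N : ℕ) : ℕ :=
  Set.ncard {x : ℝ | ∃ m n : ℕ, 1 ≤ m ∧ m ≤ N ∧ 1 ≤ n ∧ n ≤ N ∧ m ≠ n ∧
    x = |a m - a n|}

/-- `Log x = max (1, log x)`. -/
noncomputable def Log (x : ℝ) : ℝ := max 1 (Real.log x)

/-- Iterated logarithm `log₂ x = Log (Log x)`. -/
noncomputable def Log2 (x : ℝ) : ℝ := Log (Log x)

/-- The infimum `inf_{n ≥ 1} a_n` of the terms of the sequence. -/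
noncomputable def seqInf (a : ℕ → ℝ) : ℝ := sInf {x : ℝ | ∃ n : ℕ, 1 ≤ n ∧ x = a n}

lemma one_le_Log (x : ℝ) : 1 ≤ Log x := le_max_left _ _

lemma Log_pos (x : ℝ) : 0 < Log x := one_pos.trans_le (one_le_Log x)

lemma Log_le_Log {x y : ℝ} (hx : 0 < x) (hxy : x ≤ y) : Log x ≤ Log y :=
  max_le_max le_rfl (Real.log_le_log hx hxy)

lemma one_le_Log2 (x : ℝ) : 1 ≤ Log2 x := one_le_Log _

lemma Log2_pos (x : ℝ) : 0 < Log2 x := Log_pos _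

lemma Log2_le_Log2 {x y : ℝ} (hx : 0 < x) (hxy : x ≤ y) : Log2 x ≤ Log2 y :=
  Log_le_Log (Log_pos x) (Log_le_Log hx hxy)

lemma Log_two_mul_le {x : ℝ} (hx : 0 < x) : Log (2 * x) ≤ 2 * Log x := by
  have h1 := one_le_Log x
  have h2 : Real.log x ≤ Log x := le_max_right _ _
  have h3 := Real.log_two_lt_d9
  refine max_le (by linarith) ?_
  rw [Real.log_mul two_ne_zero hx.ne']
  linarith

lemma Log_four_mul_le {x : ℝ} (hx : 0 < x) : Log (4 * x) ≤ 4 * Log x := by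
  have h1 := Log_two_mul_le hx
  have h2 := Log_two_mul_le (x := 2 * x) (by positivity)
  rw [← mul_assoc] at h2
  norm_num at h2
  linarith

lemma Log_sq_le (x : ℝ) : Log (x ^ 2) ≤ 2 * Log x := by
  have h1 := one_le_Log x
  have h2 : Real.log x ≤ Log x := le_max_right _ _
  refine max_le (by linarith) ?_
  rw [Real.log_pow]
  push_cast
  linarith

lemma Log2_sq_le (x : ℝ) : Log2 (x ^ 2) ≤ 2 * Log2 x :=
  (Log_le_Log (Log_pos _) (Log_sq_le x)).trans (Log_two_mul_le (Log_pos x))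

lemma div_four_le_Log_two_pow (k : ℕ) : ((k : ℝ) + 1) / 4 ≤ Log ((2 : ℝ) ^ k) := by
  have h1 := one_le_Log ((2 : ℝ) ^ k)
  have h2 : Real.log ((2 : ℝ) ^ k) ≤ Log ((2 : ℝ) ^ k) := le_max_right _ _
  rw [Real.log_pow] at h2
  have h3 := Real.log_two_gt_d9
  rcases Nat.eq_zero_or_pos k with rfl | hk
  · norm_num at h1 ⊢
    linarith
  · have hk' : (1 : ℝ) ≤ k := by exact_mod_cast hk
    nlinarith

lemma Log_div_four_le_Log2_two_pow (k : ℕ) :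
    Log ((k : ℝ) + 1) / 4 ≤ Log2 ((2 : ℝ) ^ k) := by
  have h1 := Log_le_Log (by positivity) (div_four_le_Log_two_pow k)
  have h2 := Log_four_mul_le (x := ((k : ℝ) + 1) / 4) (by positivity)
  rw [mul_div_cancel₀ _ (four_ne_zero)] at h2
  unfold Log2
  linarith

lemma summable_inv_mul_Log_rpow {ε : ℝ} (hε : 0 < ε) :
    Summable fun k : ℕ => ((k : ℝ) * Log k ^ (1 + ε))⁻¹ := by
  have hL (x : ℝ) := Log_pos x
  rw [← summable_condensed_iff_of_nonneg]
  · have hs : Summable fun k : ℕ => (4 : ℝ) ^ (1 + ε) * (((k + 1 : ℕ) : ℝ) ^ (1 + ε))⁻¹ :=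
      ((summable_nat_add_iff (f := fun k : ℕ => ((k : ℝ) ^ (1 + ε))⁻¹) 1).2
        (Real.summable_nat_rpow_inv.2 (by linarith))).mul_left _
    refine Summable.of_nonneg_of_le (fun k => ?_) (fun k => ?_) hs
    · have := hL ((2 ^ k : ℕ) : ℝ)
      positivity
    · have h1 := div_four_le_Log_two_pow k
      have h2 : (((k : ℝ) + 1) / 4) ^ (1 + ε) ≤ Log ((2 : ℝ) ^ k) ^ (1 + ε) :=
        Real.rpow_le_rpow (by positivity) h1 (by linarith)
      have h3 := inv_anti₀ (by positivity) h2
      push_cast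
      rw [mul_inv, mul_inv_cancel_left₀ (by positivity)]
      refine h3.trans (le_of_eq ?_)
      rw [Real.div_rpow (by positivity) (by positivity), inv_div, div_eq_mul_inv]
  · intro k
    have := hL k
    positivity
  · intro m n hm hmn
    have hm' : (0 : ℝ) < m := by exact_mod_cast hm
    have hmn' : (m : ℝ) ≤ n := by exact_mod_cast hmn
    have := hL m
    have := Log_le_Log hm' hmn'
    gcongr

/-- The weight `log x (log₂ x)^{1+ε}`. -/
noncomputable def weight (ε : ℝ) (x : ℝ) : ℝ := Log x * Log2 x ^ (1 + ε)

lemma one_le_weight {ε : ℝ} (hε : 0 < ε) (x : ℝ) : 1 ≤ weight ε x :=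
  one_le_mul_of_one_le_of_one_le (one_le_Log x)
    (Real.one_le_rpow (one_le_Log2 x) (by linarith))

lemma weight_le_weight {ε : ℝ} (hε : 0 < ε) {x y : ℝ} (hx : 0 < x) (hxy : x ≤ y) :
    weight ε x ≤ weight ε y := by
  have := Log_pos x
  have := Log_pos y
  have := Log2_pos x
  have := Log_le_Log hx hxy
  have := Log2_le_Log2 hx hxy
  unfold weight
  gcongr

lemma weight_le_of_le_sq {ε : ℝ} (hε : 0 < ε) {x y : ℝ} (hx : 0 < x)
    (hxy : x ≤ y ^ 2) : weight ε x ≤ 2 * 2 ^ (1 + ε) * weight ε y := by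
  have := Log_pos y
  have := Log2_pos y
  have := Log2_pos (y ^ 2)
  calc weight ε x ≤ weight ε (y ^ 2) := weight_le_weight hε hx hxy
    _ ≤ (2 * Log y) * (2 * Log2 y) ^ (1 + ε) := by
      have := Log_sq_le y
      have := Log2_sq_le y
      unfold weight
      gcongr
    _ = _ := by
      rw [Real.mul_rpow (by positivity) (by positivity), weight]
      ring

lemma inv_mul_weight_antitone {ε : ℝ} (hε : 0 < ε) ⦃m n : ℕ⦄ (hm : 0 < m) (hmn : m ≤ n) :
    ((n : ℝ) * weight ε n)⁻¹ ≤ ((m : ℝ) * weight ε m)⁻¹ := by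
  have hm' : (0 : ℝ) < m := by exact_mod_cast hm
  have hmn' : (m : ℝ) ≤ n := by exact_mod_cast hmn
  have := one_le_weight hε m
  have := weight_le_weight hε hm' hmn'
  gcongr

lemma inv_mul_weight_nonneg {ε : ℝ} (hε : 0 < ε) (n : ℕ) :
    0 ≤ ((n : ℝ) * weight ε n)⁻¹ := by
  have := one_le_weight hε n
  positivity

lemma summable_inv_mul_weight {ε : ℝ} (hε : 0 < ε) :
    Summable fun k : ℕ => ((k : ℝ) * weight ε k)⁻¹ := by
  rw [← summable_condensed_iff_of_nonneg (inv_mul_weight_nonneg hε) (inv_mul_weight_antitone hε)]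
  have hs : Summable fun k : ℕ =>
      4 * (4 : ℝ) ^ (1 + ε) * (((k + 1 : ℕ) : ℝ) * Log (k + 1 : ℕ) ^ (1 + ε))⁻¹ :=
    ((summable_nat_add_iff (f := fun k : ℕ => ((k : ℝ) * Log k ^ (1 + ε))⁻¹) 1).2
      (summable_inv_mul_Log_rpow hε)).mul_left _
  refine Summable.of_nonneg_of_le (fun k => ?_) (fun k => ?_) hs
  · have := inv_mul_weight_nonneg hε (2 ^ k)
    positivity
  · have h1 := div_four_le_Log_two_pow k
    have h2 := Log_div_four_le_Log2_two_pow k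
    have h0 := Log_pos ((k : ℝ) + 1)
    have h0' := Log_pos ((2 : ℝ) ^ k)
    push_cast
    rw [mul_inv, mul_inv_cancel_left₀ (by positivity)]
    have h3 : ((k : ℝ) + 1) / 4 * (Log ((k : ℝ) + 1) / 4) ^ (1 + ε) ≤ weight ε (2 ^ k) := by
      unfold weight
      gcongr
    refine (inv_anti₀ (by positivity) h3).trans (le_of_eq ?_)
    rw [Real.div_rpow (by positivity) (by positivity)]
    field_simp

lemma summable_sub_mul_of_monotone {u : ℕ → ℕ} {g : ℕ → ℝ} (hu : Monotone u)
    (hpos : ∀ n, 0 < u n) (hg0 : ∀ n, 0 ≤ g n)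
    (hg : ∀ ⦃m n⦄, 0 < m → m ≤ n → g n ≤ g m) (hs : Summable g) :
    Summable fun n => ((u (n + 1) - u n : ℕ) : ℝ) * g (u (n + 1)) := by
  refine summable_of_sum_range_le (c := ∑' n, g n)
    (fun n => mul_nonneg (Nat.cast_nonneg _) (hg0 _)) fun n => ?_
  have h := Finset.sum_schlomilch_le' (f := g) (u := u)
    (fun m n hm hmn => hg (zero_lt_one.trans hm) hmn) hpos hu n
  simp only [nsmul_eq_mul] at h
  exact h.trans (hs.sum_le_tsum _ fun i _ => hg0 i)

lemma nint_nonneg (x : ℝ) : 0 ≤ nint x := abs_nonneg _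

lemma nint_le_half (x : ℝ) : nint x ≤ 1 / 2 := abs_sub_round x

lemma nint_neg (x : ℝ) : nint (-x) = nint x := by
  have key (y : ℝ) : nint (-y) ≤ nint y := by
    refine (round_le (-y) (-round y)).trans (le_of_eq ?_)
    rw [nint, ← abs_neg]
    push_cast
    ring_nf
  refine le_antisymm (key x) ?_
  simpa using key (-x)

lemma nint_mul_abs (α x : ℝ) : nint (α * |x|) = nint (α * x) := by
  rcases abs_choice x with h | h <;> rw [h]
  rw [mul_neg, nint_neg]

lemma volume_nint_mul_lt_le {d ψ : ℝ} (hd : 0 < d) (hψ : 0 ≤ ψ) :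
    volume.restrict (Set.Icc (0 : ℝ) 1) {α | nint (α * d) < ψ} ≤
      ENNReal.ofReal (2 * ψ + 3 * (ψ / d)) := by
  rw [Measure.restrict_apply' measurableSet_Icc]
  set K := ⌊d + 1 / 2⌋₊ with hK
  have hsub : {α | nint (α * d) < ψ} ∩ Set.Icc (0 : ℝ) 1 ⊆
      ⋃ k ∈ Finset.range (K + 1), Metric.ball ((k : ℝ) / d) (ψ / d) := by
    rintro α ⟨h, h0, h1⟩
    simp only [Set.mem_ofPred_eq, nint] at h
    have hr := abs_le.1 (abs_sub_round (α * d))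
    have hr0 : 0 ≤ round (α * d) := by
      have h2 : (-1 : ℝ) < round (α * d) := by nlinarith [mul_nonneg h0 hd.le]
      have h3 : (-1 : ℤ) < round (α * d) := by exact_mod_cast h2
      omega
    obtain ⟨k, hk⟩ := Int.eq_ofNat_of_zero_le hr0
    rw [hk] at h hr
    push_cast at h hr
    simp only [Set.mem_iUnion, Finset.mem_range]
    refine ⟨k, ?_, ?_⟩
    · refine Nat.lt_succ_of_le (Nat.le_floor ?_)
      nlinarith
    · rw [Metric.mem_ball, Real.dist_eq, lt_div_iff₀ hd]
      calc |α - k / d| * d = |(α - k / d) * d| := by rw [abs_mul, abs_of_pos hd]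
        _ = |α * d - k| := by congr 1; field_simp
        _ < ψ := h
  refine (measure_mono hsub).trans ((measure_biUnion_finset_le _ _).trans ?_)
  simp only [Real.volume_ball, Finset.sum_const, Finset.card_range]
  rw [← ENNReal.ofReal_nsmul]
  refine ENNReal.ofReal_le_ofReal ?_
  have hKle : (K : ℝ) ≤ d + 1 / 2 := Nat.floor_le (by positivity)
  rw [nsmul_eq_mul]
  push_cast
  have h1 : ((K : ℝ) + 1) * (2 * (ψ / d)) ≤ (d + 1 / 2 + 1) * (2 * (ψ / d)) := by gcongr
  refine h1.trans (le_of_eq ?_)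
  field_simp
  ring

lemma ae_nint_mul_ne_zero {d : ℝ} (hd : d ≠ 0) (μ : Measure ℝ) [NullSingletonClass μ] :
    ∀ᵐ α ∂μ, nint (α * d) ≠ 0 := by
  have hc : (Set.range fun k : ℤ => (k : ℝ) / d).Countable := Set.countable_range _
  filter_upwards [hc.ae_notMem μ] with α hα h
  refine hα ⟨round (α * d), ?_⟩
  have := sub_eq_zero.1 (abs_eq_zero.1 h)
  simp only
  rw [← this]
  field_simp

/-- The finite set of absolute differences counted by `Dcard`. -/
noncomputable def diffs (b : ℕ → ℝ) (N : ℕ) : Finset ℝ :=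
  (((Finset.Icc 1 N) ×ˢ (Finset.Icc 1 N)).filter fun p => p.1 ≠ p.2).image
    fun p => |b p.1 - b p.2|

lemma mem_diffs {b : ℕ → ℝ} {N : ℕ} {x : ℝ} : x ∈ diffs b N ↔
    ∃ m n : ℕ, 1 ≤ m ∧ m ≤ N ∧ 1 ≤ n ∧ n ≤ N ∧ m ≠ n ∧ x = |b m - b n| := by
  simp only [diffs, Finset.mem_image, Finset.mem_filter, Finset.mem_product, Finset.mem_Icc,
    Prod.exists]
  constructor
  · rintro ⟨m, n, ⟨⟨⟨h1, h2⟩, h3, h4⟩, h5⟩, rfl⟩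
    exact ⟨m, n, h1, h2, h3, h4, h5, rfl⟩
  · rintro ⟨m, n, h1, h2, h3, h4, h5, rfl⟩
    exact ⟨m, n, ⟨⟨⟨h1, h2⟩, h3, h4⟩, h5⟩, rfl⟩

lemma Dcard_eq_card (b : ℕ → ℝ) (N : ℕ) : Dcard b N = (diffs b N).card := by
  rw [Dcard, ← Set.ncard_coe_finset]
  congr 1
  ext x
  simp [mem_diffs]

lemma diffs_mono (b : ℕ → ℝ) : Monotone (diffs b) := by
  intro M N h x hx
  obtain ⟨m, n, h1, h2, h3, h4, h5, rfl⟩ := mem_diffs.1 hx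
  exact mem_diffs.2 ⟨m, n, h1, h2.trans h, h3, h4.trans h, h5, rfl⟩

lemma card_diffs_pos (b : ℕ → ℝ) {N : ℕ} (hN : 2 ≤ N) : 0 < (diffs b N).card :=
  Finset.card_pos.2 ⟨_, mem_diffs.2 ⟨1, 2, le_rfl, by omega, by omega, hN, by omega, rfl⟩⟩

lemma card_diffs_le_sq (b : ℕ → ℝ) (N : ℕ) : (diffs b N).card ≤ N ^ 2 := by
  refine Finset.card_image_le.trans ((Finset.card_filter_le _ _).trans ?_)
  simp [sq]

lemma deltaMin_le_half (b : ℕ → ℝ) (α : ℝ) {N : ℕ} (hN : 2 ≤ N) : deltaMin b α N ≤ 1 / 2 := by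
  refine le_trans (csInf_le ⟨0, ?_⟩ ⟨1, 2, le_rfl, by omega, by omega, hN, by omega, rfl⟩)
    (nint_le_half _)
  rintro _ ⟨m, n, -, -, -, -, -, rfl⟩
  exact nint_nonneg _

lemma le_deltaMin {b : ℕ → ℝ} {α ψ : ℝ} {N : ℕ} (hN : 2 ≤ N)
    (h : ∀ d ∈ diffs b N, ψ ≤ nint (α * d)) : ψ ≤ deltaMin b α N := by
  refine le_csInf ⟨_, 1, 2, le_rfl, by omega, by omega, hN, by omega, rfl⟩ ?_
  rintro _ ⟨m, n, h1, h2, h3, h4, h5, rfl⟩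
  rw [← nint_mul_abs]
  exact h _ (mem_diffs.2 ⟨m, n, h1, h2, h3, h4, h5, rfl⟩)

/-- The lower bound for `deltaMin b α N` when the first `N` terms of `b` are `c N`-separated. -/
noncomputable def gapBound (b : ℕ → ℝ) (c : ℕ → ℝ) (ε : ℝ) (N : ℕ) : ℝ :=
  c N / ((diffs b N).card * weight ε N)

lemma gapBound_nonneg {b c : ℕ → ℝ} {ε : ℝ} (hε : 0 < ε) (hcpos : ∀ N, 1 ≤ N → 0 < c N) {N : ℕ}
    (hN : 1 ≤ N) : 0 ≤ gapBound b c ε N := by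
  have := hcpos N hN
  have := one_le_weight hε N
  unfold gapBound
  positivity

lemma gapBound_anti {b c : ℕ → ℝ} {ε : ℝ} (hε : 0 < ε) (hcpos : ∀ N, 1 ≤ N → 0 < c N)
    (hcmono : ∀ M N, 1 ≤ M → M ≤ N → c N ≤ c M) {M N : ℕ} (hM : 2 ≤ M) (h : M ≤ N) :
    gapBound b c ε N ≤ gapBound b c ε M := by
  have hc := hcpos M (by omega)
  have h1 := hcmono M N (by omega) h
  have h2 : (0 : ℝ) < (diffs b M).card := by exact_mod_cast card_diffs_pos b hM
  have h3 : ((diffs b M).card : ℝ) ≤ (diffs b N).card := by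
    exact_mod_cast Finset.card_le_card (diffs_mono b h)
  have hM' : (0 : ℝ) < M := by positivity
  have h4 : weight ε M ≤ weight ε N := weight_le_weight hε hM' (by exact_mod_cast h)
  have h5 := one_le_weight hε M
  unfold gapBound
  gcongr

lemma tendsto_gapBound {b c : ℕ → ℝ} {ε : ℝ} (hε : 0 < ε) (hcpos : ∀ N, 1 ≤ N → 0 < c N)
    (hcmono : ∀ M N, 1 ≤ M → M ≤ N → c N ≤ c M) :
    Tendsto (gapBound b c ε) atTop (nhds 0) := by
  have hlog : Tendsto (fun N : ℕ => Real.log N) atTop atTop :=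
    Real.tendsto_log_atTop.comp tendsto_natCast_atTop_atTop
  refine squeeze_zero' ?_ ?_ ((hlog.const_div_atTop (c 1)))
  · filter_upwards [eventually_ge_atTop 1] with N hN using gapBound_nonneg hε hcpos hN
  · filter_upwards [eventually_ge_atTop 2] with N hN
    have hc := hcpos 1 le_rfl
    have h1 := hcmono 1 N le_rfl (by omega)
    have h2 : (1 : ℝ) ≤ (diffs b N).card := by exact_mod_cast card_diffs_pos b hN
    have h3 : 0 < Real.log N := Real.log_pos (by exact_mod_cast hN)
    have h4 : Real.log N ≤ Log N := le_max_right _ _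
    have h5 : 1 ≤ Log2 N ^ (1 + ε) := Real.one_le_rpow (one_le_Log2 _) (by linarith)
    have h6 : Log N ≤ weight ε N := le_mul_of_one_le_right (Log_pos _).le h5
    have h7 : Real.log N ≤ (diffs b N).card * weight ε N := by
      nlinarith [one_le_weight hε N]
    unfold gapBound
    gcongr

lemma ae_eventually_gapBound_le_nint {b c : ℕ → ℝ} {ε : ℝ} (hε : 0 < ε)
    (hcpos : ∀ N, 1 ≤ N → 0 < c N) (hcmono : ∀ M N, 1 ≤ M → M ≤ N → c N ≤ c M)
    (hsep : ∀ N, ∀ d ∈ diffs b N, c N ≤ d) :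
    ∀ᵐ α ∂(volume.restrict (Set.Icc (0 : ℝ) 1)), ∀ᶠ n in atTop,
      ∀ d ∈ diffs b (n + 3) \ diffs b (n + 2), gapBound b c ε (n + 3) ≤ nint (α * d) := by
  set C : ℝ := (2 * c 1 + 3) * (2 * 2 ^ (1 + ε)) with hC
  have hc1 := hcpos 1 le_rfl
  have hsum : Summable fun n => C * (((diffs b (n + 3)).card - (diffs b (n + 2)).card : ℕ) *
      (((diffs b (n + 3)).card : ℝ) * weight ε (diffs b (n + 3)).card)⁻¹) :=
    (summable_sub_mul_of_monotone (u := fun n => (diffs b (n + 2)).card)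
      (fun m n h => Finset.card_le_card (diffs_mono b (by omega)))
      (fun n => card_diffs_pos b (by omega)) (inv_mul_weight_nonneg hε)
      (inv_mul_weight_antitone hε) (summable_inv_mul_weight hε)).mul_left C
  have hBC := ae_eventually_notMem (μ := volume.restrict (Set.Icc (0 : ℝ) 1))
    (s := fun n => ⋃ d ∈ diffs b (n + 3) \ diffs b (n + 2),
      {α | nint (α * d) < gapBound b c ε (n + 3)}) ?_
  · filter_upwards [hBC] with α hα
    filter_upwards [hα] with n hn d hd
    by_contra! hlt
    exact hn (Set.mem_biUnion (Finset.mem_coe.2 hd) hlt)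
  refine ne_top_of_le_ne_top hsum.tsum_ofReal_ne_top (ENNReal.tsum_le_tsum fun n => ?_)
  refine (measure_biUnion_finset_le _ _).trans ?_
  set D := (diffs b (n + 3)).card with hD
  have hD0 : (0 : ℝ) < D := by exact_mod_cast card_diffs_pos b (by omega)
  have hc := hcpos (n + 3) (by omega)
  have hcle := hcmono 1 (n + 3) le_rfl (by omega)
  have hw := one_le_weight hε ((n + 3 : ℕ) : ℝ)
  have hwD := one_le_weight hε (D : ℝ)
  have hwle : weight ε D ≤ 2 * 2 ^ (1 + ε) * weight ε ((n + 3 : ℕ) : ℝ) :=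
    weight_le_of_le_sq hε hD0 (by exact_mod_cast card_diffs_le_sq b (n + 3))
  have hψ := gapBound_nonneg (b := b) hε hcpos (N := n + 3) (by omega)
  have hinv : ((D : ℝ) * weight ε ((n + 3 : ℕ) : ℝ))⁻¹ ≤
      2 * 2 ^ (1 + ε) * ((D : ℝ) * weight ε D)⁻¹ := by
    rw [← div_eq_mul_inv, inv_eq_one_div, div_le_div_iff₀ (by positivity) (by positivity)]
    nlinarith
  have hterm : ∀ d ∈ diffs b (n + 3) \ diffs b (n + 2),
      volume.restrict (Set.Icc (0 : ℝ) 1) {α | nint (α * d) < gapBound b c ε (n + 3)} ≤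
        ENNReal.ofReal (C * ((D : ℝ) * weight ε D)⁻¹) := by
    intro d hd
    have hcd := hsep _ d (Finset.mem_sdiff.1 hd).1
    have hd0 : 0 < d := hc.trans_le hcd
    refine (volume_nint_mul_lt_le hd0 hψ).trans (ENNReal.ofReal_le_ofReal ?_)
    set I := ((D : ℝ) * weight ε ((n + 3 : ℕ) : ℝ))⁻¹ with hI
    have hI0 : 0 ≤ I := by positivity
    have hψI : gapBound b c ε (n + 3) = c (n + 3) * I := by rw [gapBound, div_eq_mul_inv]
    have h1 : gapBound b c ε (n + 3) / d ≤ I := by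
      rw [hψI, div_le_iff₀ hd0]
      nlinarith
    have h2 : gapBound b c ε (n + 3) ≤ c 1 * I := by
      rw [hψI]
      gcongr
    calc 2 * gapBound b c ε (n + 3) + 3 * (gapBound b c ε (n + 3) / d)
        ≤ (2 * c 1 + 3) * I := by linarith
      _ ≤ (2 * c 1 + 3) * (2 * 2 ^ (1 + ε) * ((D : ℝ) * weight ε D)⁻¹) := by gcongr
      _ = C * ((D : ℝ) * weight ε D)⁻¹ := by rw [hC]; ring
  refine (Finset.sum_le_sum hterm).trans (le_of_eq ?_)
  rw [Finset.sum_const, Finset.card_sdiff_of_subset (diffs_mono b (by omega)),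
    ← ENNReal.ofReal_nsmul, nsmul_eq_mul]
  congr 1
  ring

lemma ae_eventually_gapBound_le_deltaMin {b c : ℕ → ℝ} {ε : ℝ} (hε : 0 < ε)
    (hcpos : ∀ N, 1 ≤ N → 0 < c N) (hcmono : ∀ M N, 1 ≤ M → M ≤ N → c N ≤ c M)
    (hsep : ∀ N, ∀ d ∈ diffs b N, c N ≤ d) :
    ∀ᵐ α ∂(volume.restrict (Set.Icc (0 : ℝ) 1)), ∀ᶠ N in atTop,
      gapBound b c ε N ≤ deltaMin b α N ∧ deltaMin b α N ≤ 1 - gapBound b c ε N := by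
  have hne : ∀ᵐ α ∂(volume.restrict (Set.Icc (0 : ℝ) 1)),
      ∀ N, ∀ d ∈ diffs b N, nint (α * d) ≠ 0 := by
    refine ae_all_iff.2 fun N => (ae_ball_iff (diffs b N).countable_toSet).2 fun d hd => ?_
    refine ae_nint_mul_ne_zero (ne_of_gt ?_) _
    obtain ⟨m, n, h1, h2, -⟩ := mem_diffs.1 hd
    exact (hcpos N (h1.trans h2)).trans_le (hsep N d hd)
  have hlim := tendsto_gapBound (b := b) hε hcpos hcmono
  filter_upwards [hne, ae_eventually_gapBound_le_nint hε hcpos hcmono hsep] with α h0 hα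
  obtain ⟨n₁, hn₁⟩ := eventually_atTop.1 hα
  have hind : ∀ n, n₁ ≤ n → ∀ d ∈ diffs b (n + 2),
      d ∈ diffs b (n₁ + 2) ∨ gapBound b c ε (n + 2) ≤ nint (α * d) := by
    intro n hn
    induction n, hn using Nat.le_induction with
    | base => exact fun d hd => Or.inl hd
    | succ n hn ih =>
      intro d hd
      by_cases hd' : d ∈ diffs b (n + 2)
      · exact (ih d hd').imp_right
          ((gapBound_anti hε hcpos hcmono (by omega) (by omega)).trans)
      · exact Or.inr (hn₁ n hn d (Finset.mem_sdiff.2 ⟨hd, hd'⟩))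
  have hfin : ∀ᶠ N in atTop, ∀ d ∈ diffs b (n₁ + 2), gapBound b c ε N ≤ nint (α * d) :=
    (Filter.eventually_all_finset _).2 fun d hd => hlim.eventually_le_const
      (lt_of_le_of_ne (nint_nonneg _) (h0 _ d hd).symm)
  filter_upwards [hfin, eventually_ge_atTop (n₁ + 2),
    hlim.eventually_le_const (show (0 : ℝ) < 1 / 2 by norm_num)] with N h1 h2 h3
  have hN : 2 ≤ N := by omega
  refine ⟨le_deltaMin hN fun d hd => ?_, by linarith [deltaMin_le_half b α hN]⟩
  obtain ⟨n, rfl⟩ : ∃ n, N = n + 2 := ⟨N - 2, by omega⟩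
  exact (hind n (by omega) d hd).elim (h1 d) id

lemma mul_abs_sub_le_of_le_abs_deriv {f f' : ℝ → ℝ} {s δ : ℝ}
    (hfderiv : ∀ x ∈ Set.Ici s, HasDerivWithinAt f (f' x) (Set.Ici s) x)
    (hf' : ∀ x ∈ Set.Ici s, δ ≤ |f' x|) {x y : ℝ} (hx : s ≤ x) (hy : s ≤ y) :
    |x - y| * δ ≤ |f x - f y| := by
  wlog hxy : y < x generalizing x y
  · rcases (not_lt.1 hxy).eq_or_lt with rfl | h
    · simp
    · rw [abs_sub_comm x, abs_sub_comm (f x)]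
      exact this hy hx h
  obtain ⟨z, hz, h⟩ := exists_hasDerivAt_eq_slope f f' hxy
    (fun w hw => ((hfderiv w (hy.trans hw.1)).continuousWithinAt).mono
      fun v hv => hy.trans hv.1)
    (fun w hw => (hfderiv w (hy.trans hw.1.le)).hasDerivAt
      (Ici_mem_nhds (hy.trans_lt hw.1)))
  have hpos : 0 < x - y := sub_pos.2 hxy
  have hz' := hf' z (hy.trans hz.1.le)
  rw [h, abs_div, abs_of_pos hpos, le_div_iff₀ hpos] at hz'
  rw [abs_of_pos hpos]
  linarith

theorem stmt12 (a : ℕ → ℝ) (c : ℕ → ℝ)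
    (hcpos : ∀ N, 1 ≤ N → 0 < c N)
    (hcmono : ∀ M N, 1 ≤ M → M ≤ N → c N ≤ c M)
    (hpos : ∀ n, 1 ≤ n → 0 < a n)
    (hdist : ∀ m n, 1 ≤ m → 1 ≤ n → m ≠ n → a m ≠ a n)
    (hsep : ∀ N m n, 1 ≤ m → m ≤ N → 1 ≤ n → n ≤ N → m ≠ n → c N ≤ |a m - a n|)
    (f f' : ℝ → ℝ) (δ₀ : ℝ) (hδ₀ : 0 < δ₀)
    (hfderiv : ∀ x ∈ Set.Ici (seqInf a),
      HasDerivWithinAt f (f' x) (Set.Ici (seqInf a)) x)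
    (hfpos : ∀ n, 1 ≤ n → 0 < f (a n))
    (hf' : ∀ x ∈ Set.Ici (seqInf a), δ₀ ≤ |f' x|)
    (ε : ℝ) (hε : 0 < ε) :
    ∀ᵐ α ∂(volume.restrict (Set.Icc (0:ℝ) 1)),
      ∃ N₀ : ℕ, ∀ N, N₀ ≤ N →
        c N * δ₀ / ((Dcard (fun n => f (a n)) N : ℝ) * Log (N : ℝ) *
            Log2 (N : ℝ) ^ (1 + ε)) ≤
          deltaMin (fun n => f (a n)) α N ∧
        deltaMin (fun n => f (a n)) α N ≤
          1 - c N * δ₀ / ((Dcard (fun n => f (a n)) N : ℝ) * Log (N : ℝ) *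
            Log2 (N : ℝ) ^ (1 + ε)) := by
  have hs : ∀ n, 1 ≤ n → seqInf a ≤ a n := fun n hn => by
    refine csInf_le ⟨0, ?_⟩ ⟨n, hn, rfl⟩
    rintro _ ⟨m, hm, rfl⟩
    exact (hpos m hm).le
  have hmain := ae_eventually_gapBound_le_deltaMin (b := fun n => f (a n))
    (c := fun N => c N * δ₀) hε (fun N hN => mul_pos (hcpos N hN) hδ₀)
    (fun M N hM h => mul_le_mul_of_nonneg_right (hcmono M N hM h) hδ₀.le) ?_
  · filter_upwards [hmain] with α hα
    simpa only [eventually_atTop, gapBound, weight, Dcard_eq_card, mul_assoc] using hα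
  · intro N d hd
    obtain ⟨m, n, h1, h2, h3, h4, h5, rfl⟩ := mem_diffs.1 hd
    exact (mul_le_mul_of_nonneg_right (hsep N m n h1 h2 h3 h4 h5) hδ₀.le).trans
      (mul_abs_sub_le_of_le_abs_deriv hfderiv hf' (hs m h1) (hs n h3))
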